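/- (Analytic core of Theorem 3.1.) Assume A_0 = 0, α > 1/2, β ∈ (0,1), γ > 0, μ > 0, t > 0. Then lim_{ε→0⁺} ∫_ℝ ( E_β(−μ|λ|^α (1 + λ² ε^{2β/α})^{γ/2} t^β) √(f(ε^{β/α} λ)) − √(f(0)) · E_β(−μ t^β |λ|^α) )² dλ = 0, where f(0) = ∑_{j=1}^n A_j c_1(κ_j) K_{(κ_j−1)/2}(w_j) w_j^{(κ_j−1)/2}. (This integral equals the mean-square distance E(U_ε(t,x) − U_0(t,x))² between the rescaled solution of the fractional Riesz–Bessel equation and the limit Gaussian field, and its vanishing yields the convergence of finite-dimensional distributions.) -/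

import Mathlib

open Real Filter Topology MeasureTheory

/-- The modified Bessel function of the second kind
`K_ν(z) = (1/2) ∫_0^∞ s^{ν−1} exp(−(z/2)(s + 1/s)) ds`. -/
noncomputable def besselK (ν z : ℝ) : ℝ :=
  (1 / 2) * ∫ s in Set.Ioi (0 : ℝ), s ^ (ν - 1) * Real.exp (-(z / 2) * (s + 1 / s))

/-- The spectral density
`f(λ) = (c_1(κ_0)/2) A_0 K_{(κ_0−1)/2}(|λ|)|λ|^{(κ_0−1)/2}
  + ∑_{j=1}^n (c_1(κ_j)/2) A_j (K_{(κ_j−1)/2}(|λ+w_j|)|λ+w_j|^{(κ_j−1)/2}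
                              + K_{(κ_j−1)/2}(|λ−w_j|)|λ−w_j|^{(κ_j−1)/2})`,
with `c_1(κ_0) = 2·2^{(1−κ_0)/2}/(√π Γ(κ_0/2))` and
`c_1(κ_j) = 2^{(1−κ_j)/2}/(√π Γ(κ_j/2))` for `j ≥ 1`. -/
noncomputable def specDensity (n : ℕ) (w κ A : ℕ → ℝ) (lam : ℝ) : ℝ :=
  2 * (2 : ℝ) ^ ((1 - κ 0) / 2) / (Real.sqrt Real.pi * Real.Gamma (κ 0 / 2)) / 2 * A 0 *
      besselK ((κ 0 - 1) / 2) |lam| * |lam| ^ ((κ 0 - 1) / 2) +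
    ∑ j ∈ Finset.Icc 1 n,
      (2 : ℝ) ^ ((1 - κ j) / 2) / (Real.sqrt Real.pi * Real.Gamma (κ j / 2)) / 2 * A j *
        (besselK ((κ j - 1) / 2) |lam + w j| * |lam + w j| ^ ((κ j - 1) / 2) +
          besselK ((κ j - 1) / 2) |lam - w j| * |lam - w j| ^ ((κ j - 1) / 2))

/-- The Mittag-Leffler function `E_β(s) = ∑_{k=0}^∞ s^k / Γ(1 + βk)`. -/
noncomputable def mittagLeffler (β s : ℝ) : ℝ := ∑' k : ℕ, s ^ k / Real.Gamma (1 + β * k)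

/-- The value `f(0) = ∑_{j=1}^n A_j c_1(κ_j) K_{(κ_j−1)/2}(w_j) w_j^{(κ_j−1)/2}` of the
spectral density at the origin when `A₀ = 0`. -/
noncomputable def specDensityZero (n : ℕ) (w κ A : ℕ → ℝ) : ℝ :=
  ∑ j ∈ Finset.Icc 1 n,
    A j * ((2 : ℝ) ^ ((1 - κ j) / 2) / (Real.sqrt Real.pi * Real.Gamma (κ j / 2))) *
      besselK ((κ j - 1) / 2) (w j) * (w j) ^ ((κ j - 1) / 2)

noncomputable def mlC (n : ℕ) (s : ℝ) : ℝ := ∏ j ∈ Finset.range n, (s + j) / (j + 1)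

noncomputable def mlB (s : ℝ) : PowerSeries ℝ := PowerSeries.mk (fun n => mlC n s)

lemma mlC_zero (s : ℝ) : mlC 0 s = 1 := by simp [mlC]

lemma mlC_succ (n : ℕ) (s : ℝ) : mlC (n + 1) s = mlC n s * ((s + n) / (n + 1)) := by
  rw [mlC, mlC, Finset.prod_range_succ]

lemma mlC_nonneg (n : ℕ) {s : ℝ} (hs : 0 ≤ s) : 0 ≤ mlC n s :=
  Finset.prod_nonneg fun j _ => by positivity

lemma mlC_eq_choose (n : ℕ) (s : ℝ) : mlC n s = (-1) ^ n * Ring.choose (-s) n := by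
  induction n with
  | zero => simp [mlC_zero]
  | succ n ih =>
    have h := Ring.choose_smul_choose (-s) (Nat.le_succ n)
    simp only [Nat.succ_eq_add_one, Nat.choose_succ_self_right, Nat.add_sub_cancel_left,
      Ring.choose_one_right, nsmul_eq_mul, Nat.cast_add, Nat.cast_one] at h
    have hn : (n : ℝ) + 1 ≠ 0 := by positivity
    rw [mlC_succ, ih]
    field_simp
    rw [pow_succ]
    linear_combination (-1) ^ n * h

lemma mlB_eq (s : ℝ) : mlB s = PowerSeries.rescale (-1) (PowerSeries.binomialSeries ℝ (-s)) := by
  ext n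
  simp [mlB, mlC_eq_choose]

lemma mlB_add (s t : ℝ) : mlB (s + t) = mlB s * mlB t := by
  rw [mlB_eq, mlB_eq, mlB_eq, neg_add, PowerSeries.binomialSeries_add, map_mul]

lemma mlB_zero : mlB 0 = 1 := by
  rw [mlB_eq, neg_zero, PowerSeries.binomialSeries_zero, map_one]

lemma mlC_one (n : ℕ) : mlC n 1 = 1 := by
  refine Finset.prod_eq_one fun j _ => ?_
  rw [add_comm]; exact div_self (by positivity)

lemma mlC_neg_nonpos {β : ℝ} (h0 : 0 < β) (h1 : β < 1) (n : ℕ) : mlC (n + 1) (-β) ≤ 0 := by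
  induction n with
  | zero => simp [mlC, h0.le]
  | succ n ih =>
    rw [mlC_succ]
    refine mul_nonpos_of_nonpos_of_nonneg ih (div_nonneg ?_ (by positivity))
    push_cast
    have : (0 : ℝ) ≤ n := n.cast_nonneg
    linarith

lemma mlB_coeff_mul (s : ℝ) (U : PowerSeries ℝ) (n : ℕ) :
    PowerSeries.coeff n (mlB s * U) =
      ∑ i ∈ Finset.range (n + 1), mlC i s * PowerSeries.coeff (n - i) U := by
  rw [PowerSeries.coeff_mul, Finset.Nat.sum_antidiagonal_eq_sum_range_succ_mk]
  simp [mlB]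

/-- abstract discrete comparison -/
lemma ml_discrete {β η : ℝ} (h0 : 0 < β) (h1 : β < 1) (hη : 0 ≤ η) (U : PowerSeries ℝ)
    (hU : (mlB (-β) + PowerSeries.C η) * U = mlB (1 - β)) (n : ℕ) :
    0 ≤ PowerSeries.coeff n U ∧ PowerSeries.coeff n U * (1 + η * mlC n (1 + β)) ≤ 1 := by
  have hpos : ∀ n, 0 ≤ PowerSeries.coeff n U := by
    intro n
    induction n using Nat.strong_induction_on with
    | _ n ih =>
      have h := congrArg (PowerSeries.coeff n) hU
      rw [add_mul, map_add, mlB_coeff_mul, PowerSeries.coeff_C_mul, Finset.sum_range_succ'] at h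
      have h2 : ∑ i ∈ Finset.range n, mlC (i + 1) (-β) * PowerSeries.coeff (n - (i + 1)) U ≤ 0 := by
        refine Finset.sum_nonpos fun i hi => ?_
        refine mul_nonpos_of_nonpos_of_nonneg (mlC_neg_nonpos h0 h1 i) (ih _ ?_)
        have := Finset.mem_range.1 hi
        omega
      have h3 : 0 ≤ PowerSeries.coeff n (mlB (1 - β)) := by
        simpa [mlB] using mlC_nonneg n (by linarith : 0 ≤ 1 - β)
      rw [← h] at h3
      simp only [mlC_zero, one_mul, Nat.sub_zero] at h3
      by_contra hc
      push Not at hc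
      nlinarith
  have hD : (mlB (-β) + PowerSeries.C η) * (mlB (-1) * U) = mlB (-β) := by
    calc _ = mlB (-1) * ((mlB (-β) + PowerSeries.C η) * U) := by ring
      _ = mlB (-β) := by rw [hU, ← mlB_add]; congr 1; ring
  have hDn : ∀ n, PowerSeries.coeff (n + 1) (mlB (-1) * U) ≤ 0 := by
    have hD0 : PowerSeries.coeff 0 (mlB (-1) * U) * (1 + η) = 1 := by
      have h := congrArg (PowerSeries.coeff 0) hD
      rw [add_mul, map_add, mlB_coeff_mul, PowerSeries.coeff_C_mul] at h
      simp only [zero_add, Finset.range_one, Finset.sum_singleton, mlC_zero, one_mul, mlB,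
        PowerSeries.coeff_mk, Nat.sub_zero] at h
      simp only [mlB]
      linarith
    have hD1 : PowerSeries.coeff 0 (mlB (-1) * U) ≤ 1 := by
      by_contra hc
      push Not at hc
      nlinarith
    intro n
    induction n using Nat.strong_induction_on with
    | _ n ih =>
      have h := congrArg (PowerSeries.coeff (n + 1)) hD
      rw [add_mul, map_add, mlB_coeff_mul, PowerSeries.coeff_C_mul, Finset.sum_range_succ',
        Finset.sum_range_succ] at h
      have h2 : 0 ≤ ∑ i ∈ Finset.range n, mlC (i + 1) (-β) *
          PowerSeries.coeff (n + 1 - (i + 1)) (mlB (-1) * U) := by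
        refine Finset.sum_nonneg fun i hi => ?_
        have := Finset.mem_range.1 hi
        refine mul_nonneg_of_nonpos_of_nonpos (mlC_neg_nonpos h0 h1 i) ?_
        have e : n + 1 - (i + 1) = (n - (i + 1)) + 1 := by omega
        rw [e]
        exact ih _ (by omega)
      have h3 : PowerSeries.coeff (n + 1) (mlB (-β)) = mlC (n + 1) (-β) := by simp [mlB]
      have h4 := mlC_neg_nonpos h0 h1 n
      rw [h3] at h
      simp only [mlC_zero, one_mul, Nat.sub_zero, Nat.sub_self] at h
      by_contra hc
      push Not at hc
      nlinarith
  have hanti : Antitone (fun n => PowerSeries.coeff n U) := by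
    refine antitone_nat_of_succ_le fun n => ?_
    have h := hDn n
    have e : mlB (-1) = 1 - PowerSeries.X := by
      have h1 : mlB (-1) * mlB 1 = 1 := by rw [← mlB_add]; simp [mlB_zero]
      have h2 : mlB 1 * (1 - PowerSeries.X) = 1 := by
        have : mlB 1 = PowerSeries.mk 1 := by
          ext n; simp [mlB, mlC_one]
        rw [this]; exact PowerSeries.mk_one_mul_one_sub_eq_one ℝ
      exact left_inv_eq_right_inv h1 h2
    rw [e, sub_mul, one_mul, map_sub, PowerSeries.coeff_succ_X_mul] at h
    linarith
  refine ⟨hpos n, ?_⟩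
  have hE : U + PowerSeries.C η * (mlB β * U) = mlB 1 := by
    calc _ = (mlB β * mlB (-β)) * U + PowerSeries.C η * (mlB β * U) := by
            rw [← mlB_add]; simp [mlB_zero]
      _ = mlB β * ((mlB (-β) + PowerSeries.C η) * U) := by ring
      _ = mlB 1 := by rw [hU, ← mlB_add]; congr 1; ring
  have h := congrArg (PowerSeries.coeff n) hE
  rw [map_add, PowerSeries.coeff_C_mul, mlB_coeff_mul] at h
  have h1' : PowerSeries.coeff n (mlB 1) = 1 := by simp [mlB, mlC_one]
  have hs : mlC n (1 + β) = ∑ i ∈ Finset.range (n + 1), mlC i β := by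
    have h2 : PowerSeries.coeff n (mlB (1 + β)) = PowerSeries.coeff n (mlB β * mlB 1) := by
      rw [add_comm, mlB_add]
    rw [mlB_coeff_mul] at h2
    simpa [mlB, mlC_one] using h2
  have hge : PowerSeries.coeff n U * mlC n (1 + β) ≤
      ∑ i ∈ Finset.range (n + 1), mlC i β * PowerSeries.coeff (n - i) U := by
    rw [hs, Finset.mul_sum]
    refine Finset.sum_le_sum fun i _ => ?_
    rw [mul_comm]
    exact mul_le_mul_of_nonneg_left (hanti (Nat.sub_le n i)) (mlC_nonneg i h0.le)
  rw [h1'] at h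
  nlinarith

lemma mlC_le_pow (n k : ℕ) {β : ℝ} (h0 : 0 < β) (h1 : β < 1) (a : ℝ) (ha : a ≤ 1)
    (ha' : 0 ≤ a) : mlC n (a + β * k) ≤ (1 + k : ℝ) ^ n := by
  unfold mlC
  calc _ ≤ ∏ j ∈ Finset.range n, (1 + k : ℝ) := by
        refine Finset.prod_le_prod (fun j _ => by positivity) fun j _ => ?_
        rw [div_le_iff₀ (by positivity)]
        have hk : (0 : ℝ) ≤ k := k.cast_nonneg
        have hj : (0 : ℝ) ≤ j := j.cast_nonneg
        nlinarith [mul_nonneg hk hj, mul_nonneg hk (sub_nonneg.2 h1.le)]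
    _ = _ := by simp

lemma summable_one_add_pow (n : ℕ) {r : ℝ} (hr0 : 0 ≤ r) (hr : r < 1) :
    Summable (fun k : ℕ => (1 + k : ℝ) ^ n * r ^ k) := by
  have h := summable_pow_mul_geometric_of_norm_lt_one (R := ℝ) n (r := r)
    (by rwa [Real.norm_of_nonneg hr0])
  have h3 := (h.mul_left ((2:ℝ)^n)).add (summable_geometric_of_lt_one hr0 hr)
  refine Summable.of_nonneg_of_le (fun k => by positivity) (fun k => ?_) h3
  rcases Nat.eq_zero_or_pos k with rfl | hk
  · simp
  · have hk' : (1 : ℝ) ≤ k := by exact_mod_cast hk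
    have : (1 + k : ℝ) ^ n ≤ 2 ^ n * k ^ n := by
      rw [← mul_pow]; exact pow_le_pow_left₀ (by positivity) (by linarith) n
    have h4 : 0 ≤ r ^ k := by positivity
    nlinarith

lemma ml_summable {β : ℝ} (h0 : 0 < β) (h1 : β < 1) {η : ℝ} (hη : |η| < 1) (n : ℕ) (a : ℝ)
    (ha : a ≤ 1) (ha' : 0 ≤ a) :
    Summable (fun k : ℕ => η ^ k * mlC n (a + β * k)) := by
  refine Summable.of_norm_bounded (summable_one_add_pow n (abs_nonneg η) hη) fun k => ?_
  rw [norm_mul, norm_pow, Real.norm_eq_abs, Real.norm_eq_abs,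
    abs_of_nonneg (mlC_nonneg n (by positivity)), mul_comm]
  exact mul_le_mul_of_nonneg_right (mlC_le_pow n k h0 h1 a ha ha') (by positivity)

lemma ml_u_bound {β η : ℝ} (h0 : 0 < β) (h1 : β < 1) (hη : 0 ≤ η) (hη1 : η < 1) (n : ℕ) :
    0 ≤ (∑' k : ℕ, (-η) ^ k * mlC n (1 + β * k)) ∧
    (∑' k : ℕ, (-η) ^ k * mlC n (1 + β * k)) * (1 + η * mlC n (1 + β)) ≤ 1 := by
  have habs : |-η| < 1 := by rwa [abs_neg, abs_of_nonneg hη]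
  set U : PowerSeries ℝ := PowerSeries.mk (fun n => ∑' k : ℕ, (-η) ^ k * mlC n (1 + β * k)) with hUd
  have hU : (mlB (-β) + PowerSeries.C η) * U = mlB (1 - β) := by
    ext m
    have hsum : ∀ m, Summable (fun k : ℕ => (-η) ^ k * mlC m (1 + β * k)) := fun m =>
      ml_summable h0 h1 habs m 1 le_rfl zero_le_one
    have hsum2 : Summable (fun k : ℕ => (-η) ^ k * mlC m (1 - β + β * k)) :=
      ml_summable h0 h1 habs m (1 - β) (by linarith) (by linarith)
    rw [add_mul, map_add, mlB_coeff_mul, PowerSeries.coeff_C_mul]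
    have e1 : ∑ i ∈ Finset.range (m + 1), mlC i (-β) * PowerSeries.coeff (m - i) U =
        ∑' k : ℕ, (-η) ^ k * mlC m (1 - β + β * k) := by
      simp only [hUd, PowerSeries.coeff_mk, ← tsum_mul_left]
      rw [← Summable.tsum_finsetSum (fun i _ => (hsum (m - i)).mul_left _)]
      refine tsum_congr fun k => ?_
      have h2 : PowerSeries.coeff m (mlB (1 - β + β * k)) =
          PowerSeries.coeff m (mlB (-β) * mlB (1 + β * k)) := by
        rw [← mlB_add]; congr 2; ring
      rw [mlB_coeff_mul] at h2
      simp only [mlB, PowerSeries.coeff_mk] at h2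
      rw [h2, Finset.mul_sum]
      exact Finset.sum_congr rfl fun i _ => by ring
    rw [e1, hsum2.tsum_eq_zero_add]
    simp only [hUd, mlB, PowerSeries.coeff_mk, ← tsum_mul_left]
    have e2 : ∀ k : ℕ, (-η) ^ (k + 1) * mlC m (1 - β + β * ((k + 1 : ℕ) : ℝ)) =
        - (η * ((-η) ^ k * mlC m (1 + β * k))) := by
      intro k
      have : 1 - β + β * ((k + 1 : ℕ) : ℝ) = 1 + β * k := by push_cast; ring
      rw [this]; ring
    simp only [e2, tsum_neg]
    simp
  have := ml_discrete h0 h1 hη U hU n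
  simpa [hUd] using this

lemma mlC_ratio_anti {s : ℝ} (hs : 0 ≤ s) (n : ℕ) (hn : 1 ≤ n) :
    mlC (n + 1) (1 + s) * ((n + 1 : ℕ) : ℝ) ^ (-s) ≤ mlC n (1 + s) * (n : ℝ) ^ (-s) := by
  rw [mlC_succ, mul_assoc]
  refine mul_le_mul_of_nonneg_left ?_ (mlC_nonneg n (by linarith))
  have hn' : (0 : ℝ) < n := by exact_mod_cast hn
  have hm : (0 : ℝ) < n + 1 := by positivity
  push_cast
  have e1 : (1 + s + n) / (n + 1) ≤ Real.exp (s / (n + 1)) := by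
    have := Real.add_one_le_exp (s / (n + 1))
    calc (1 + s + n) / (n + 1) = s / (n + 1) + 1 := by field_simp; ring
      _ ≤ _ := this
  have e2 : Real.exp (s / (n + 1)) ≤ ((n + 1) / n : ℝ) ^ s := by
    rw [Real.rpow_def_of_pos (by positivity)]
    apply Real.exp_le_exp.2
    have := Real.one_sub_inv_le_log_of_pos (x := ((n + 1) / n : ℝ)) (by positivity)
    have e : 1 - ((n + 1) / n : ℝ)⁻¹ = 1 / (n + 1) := by field_simp; ring
    rw [e] at this
    calc s / (n + 1) = 1 / (n + 1) * s := by ring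
      _ ≤ _ := mul_le_mul_of_nonneg_right this hs
  calc _ ≤ ((n + 1) / n : ℝ) ^ s * ((n : ℝ) + 1) ^ (-s) :=
        mul_le_mul_of_nonneg_right (e1.trans e2) (by positivity)
    _ = _ := by
      rw [Real.div_rpow hm.le hn'.le, Real.rpow_neg hm.le, Real.rpow_neg hn'.le]
      have := (Real.rpow_pos_of_pos hm s).ne'
      field_simp

lemma mlC_ratio_le {s : ℝ} (hs : 0 ≤ s) {N n : ℕ} (hN : 1 ≤ N) (hn : N ≤ n) :
    mlC n (1 + s) * (n : ℝ) ^ (-s) ≤ mlC N (1 + s) * (N : ℝ) ^ (-s) := by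
  induction n, hn using Nat.le_induction with
  | base => exact le_rfl
  | succ n hn ih => exact (mlC_ratio_anti hs n (hN.trans hn)).trans ih

lemma mlC_ratio_tendsto {s : ℝ} (hs : 0 ≤ s) :
    Tendsto (fun n : ℕ => mlC n (1 + s) * (n : ℝ) ^ (-s)) atTop (𝓝 (1 / Real.Gamma (1 + s))) := by
  rcases hs.eq_or_lt with rfl | hs
  · simp [mlC_one]
  have h := (Real.GammaSeq_tendsto_Gamma s).inv₀ (Real.Gamma_pos_of_pos hs).ne'
  have h2 := h.const_mul (1 / s)
  have e : 1 / s * (Real.Gamma s)⁻¹ = 1 / Real.Gamma (1 + s) := by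
    rw [add_comm, Real.Gamma_add_one hs.ne']; field_simp
  rw [e] at h2
  refine h2.congr fun n => ?_
  have hc : mlC n (1 + s) = (∏ j ∈ Finset.range n, (s + (j + 1 : ℕ))) / (n.factorial : ℝ) := by
    rw [mlC, Finset.prod_div_distrib]
    congr 1
    · refine Finset.prod_congr rfl fun j _ => by push_cast; ring
    · rw [← Finset.prod_range_add_one_eq_factorial]; push_cast; rfl
  rw [Real.GammaSeq, Finset.prod_range_succ', hc, Real.rpow_neg n.cast_nonneg]
  simp only [Nat.cast_zero, add_zero, inv_div]
  field_simp

lemma ml_exists_N {β : ℝ} (h0 : 0 < β) (x : ℝ) : ∃ N : ℕ, 1 ≤ N ∧ x * (N : ℝ) ^ (-β) < 1 := by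
  have h : Tendsto (fun n : ℕ => x * (n : ℝ) ^ (-β)) atTop (𝓝 0) := by
    simpa using ((tendsto_rpow_neg_atTop h0).comp tendsto_natCast_atTop_atTop).const_mul x
  obtain ⟨N, h1, h2⟩ := ((h.eventually (gt_mem_nhds one_pos)).and (eventually_ge_atTop 1)).exists
  exact ⟨N, h2, h1⟩

lemma ml_pow_eq {β : ℝ} (x : ℝ) (n k : ℕ) :
    (x * (n : ℝ) ^ (-β)) ^ k = x ^ k * (n : ℝ) ^ (-(β * k)) := by
  rw [mul_pow, ← Real.rpow_natCast ((n : ℝ) ^ (-β)), ← Real.rpow_mul n.cast_nonneg]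
  congr 2; ring

lemma ml_bound {β : ℝ} (h0 : 0 < β) (h1 : β < 1) {x : ℝ} (hx : 0 ≤ x) :
    0 ≤ mittagLeffler β (-x) ∧
      mittagLeffler β (-x) * (1 + x * (1 / Real.Gamma (1 + β))) ≤ 1 := by
  obtain ⟨N, hN, hN1⟩ := ml_exists_N h0 x
  have hNpos : (0:ℝ) < N := by exact_mod_cast hN
  have key : Tendsto (fun n : ℕ => ∑' k : ℕ, (-(x * (n : ℝ) ^ (-β))) ^ k * mlC n (1 + β * k)) atTop
      (𝓝 (mittagLeffler β (-x))) := by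
    refine tendsto_tsum_of_dominated_convergence
      (bound := fun k : ℕ => (x * (N : ℝ) ^ (-β)) ^ k * mlC N (1 + β * k)) ?_ ?_ ?_
    · refine ml_summable h0 h1 ?_ N 1 le_rfl zero_le_one
      rwa [abs_of_nonneg (by positivity)]
    · intro k
      have h := (mlC_ratio_tendsto (s := β * k) (by positivity)).const_mul ((-x) ^ k)
      rw [mul_one_div] at h
      refine h.congr fun n => ?_
      rw [show -(x * (n : ℝ) ^ (-β)) = (-x) * (n : ℝ) ^ (-β) by ring, ml_pow_eq]; ring
    · filter_upwards [eventually_ge_atTop N] with n hn k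
      rw [norm_mul, norm_pow, norm_neg, Real.norm_of_nonneg (by positivity),
        Real.norm_of_nonneg (mlC_nonneg n (by positivity)), ml_pow_eq, ml_pow_eq]
      have := mlC_ratio_le (s := β * k) (by positivity) hN hn
      have hxk : 0 ≤ x ^ k := by positivity
      nlinarith [mul_le_mul_of_nonneg_left this hxk]
  have hev : ∀ᶠ n : ℕ in atTop, x * (n : ℝ) ^ (-β) < 1 := by
    filter_upwards [eventually_ge_atTop N] with n hn
    refine lt_of_le_of_lt (mul_le_mul_of_nonneg_left ?_ hx) hN1
    exact Real.rpow_le_rpow_of_nonpos hNpos (by exact_mod_cast hn) (by linarith)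
  refine ⟨ge_of_tendsto key ?_, le_of_tendsto (key.mul ((((mlC_ratio_tendsto h0.le).const_mul x)).const_add 1)) ?_⟩
  · filter_upwards [hev] with n hn
    exact (ml_u_bound h0 h1 (by positivity) hn n).1
  · filter_upwards [hev] with n hn
    have := (ml_u_bound h0 h1 (by positivity) hn n).2
    have e : x * (mlC n (1 + β) * (n : ℝ) ^ (-β)) = x * (n : ℝ) ^ (-β) * mlC n (1 + β) := by ring
    rw [e]
    exact this

lemma ml_continuous {β : ℝ} (h0 : 0 < β) (h1 : β < 1) : Continuous (mittagLeffler β) := by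
  rw [continuous_iff_continuousAt]
  intro y
  obtain ⟨N, hN, hN1⟩ := ml_exists_N h0 (|y| + 1)
  have hc : ContinuousOn (mittagLeffler β) (Metric.ball 0 (|y| + 1)) := by
    unfold mittagLeffler
    refine continuousOn_tsum
      (u := fun k : ℕ => ((|y| + 1) * (N : ℝ) ^ (-β)) ^ k * mlC N (1 + β * k)) ?_ ?_ ?_
    · intro k; fun_prop
    · refine ml_summable h0 h1 ?_ N 1 le_rfl zero_le_one
      rwa [abs_of_nonneg (by positivity)]
    · intro k z hz
      have hz' : |z| ≤ |y| + 1 := by simpa using (Metric.mem_ball.1 hz).le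
      have hs : 0 ≤ β * k := by positivity
      have hG : 1 / Real.Gamma (1 + β * k) ≤ mlC N (1 + β * k) * (N : ℝ) ^ (-(β * k)) := by
        refine le_of_tendsto (mlC_ratio_tendsto hs) ?_
        filter_upwards [eventually_ge_atTop N] with n hn
        exact mlC_ratio_le hs hN hn
      have hGp : 0 < Real.Gamma (1 + β * k) := Real.Gamma_pos_of_pos (by positivity)
      rw [norm_div, norm_pow, Real.norm_of_nonneg hGp.le, Real.norm_eq_abs, ml_pow_eq]
      calc |z| ^ k / Real.Gamma (1 + β * k) = |z| ^ k * (1 / Real.Gamma (1 + β * k)) := by ring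
        _ ≤ (|y| + 1) ^ k * (mlC N (1 + β * k) * (N : ℝ) ^ (-(β * k))) := by
          refine mul_le_mul (pow_le_pow_left₀ (abs_nonneg _) hz' k) hG (by positivity) (by positivity)
        _ = _ := by ring
  refine hc.continuousAt (Metric.isOpen_ball.mem_nhds ?_)
  simp

lemma bk_integral_inv {a r : ℝ} (ha : 0 < a) (hr : 0 < r) :
    ∫ s in Set.Ioi (0 : ℝ), s ^ (-a - 1) * Real.exp (-(r * (1 / s))) = (1 / r) ^ a * Real.Gamma a := by
  rw [← Real.integral_rpow_mul_exp_neg_mul_Ioi ha hr,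
    ← integral_comp_rpow_Ioi (fun t : ℝ => t ^ (a - 1) * Real.exp (-(r * t))) (p := -1) (by norm_num)]
  refine setIntegral_congr_fun measurableSet_Ioi fun s hs => ?_
  have hs' : (0 : ℝ) < s := hs
  simp only [smul_eq_mul, abs_neg, abs_one, one_mul]
  rw [← mul_assoc, ← Real.rpow_mul hs'.le, ← Real.rpow_add hs', Real.rpow_neg_one, one_div]
  congr 2
  ring

lemma bk_integrable_inv {a r : ℝ} (ha : 0 < a) (hr : 0 < r) :
    IntegrableOn (fun s : ℝ => s ^ (-a - 1) * Real.exp (-(r * (1 / s)))) (Set.Ioi 0) := by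
  refine Integrable.of_integral_ne_zero ?_
  rw [bk_integral_inv ha hr]
  have := Real.Gamma_pos_of_pos ha
  positivity

lemma bk_pointwise {ν z s : ℝ} (hz : 0 < z) (hs : 0 < s) :
    s ^ (ν - 1) * Real.exp (-(z / 2) * (s + 1 / s)) ≤
      Real.exp (-(1 / 2 * z)) * (s ^ (-(-ν) - 1) * Real.exp (-(z / 4 * (1 / s)))) := by
  rw [neg_neg]
  have h : Real.exp (-(z / 2) * (s + 1 / s)) ≤
      Real.exp (-(1 / 2 * z)) * Real.exp (-(z / 4 * (1 / s))) := by
    rw [← Real.exp_add]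
    apply Real.exp_le_exp.2
    have h1 : 1 ≤ s + 1 / 2 * (1 / s) := by
      have : s + 1 / 2 * (1 / s) - 1 = ((s - 1 / 2) ^ 2 + 1 / 4) / s := by field_simp; ring
      have h2 : 0 ≤ ((s - 1 / 2) ^ 2 + 1 / 4) / s := by positivity
      linarith
    nlinarith
  have hp : 0 ≤ s ^ (ν - 1) := by positivity
  nlinarith [mul_le_mul_of_nonneg_left h hp]

lemma bk_meas (ν z : ℝ) :
    Measurable (fun s : ℝ => s ^ (ν - 1) * Real.exp (-(z / 2) * (s + 1 / s))) := by
  fun_prop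

lemma bk_integrable {ν z : ℝ} (hν : ν < 0) (hz : 0 < z) :
    IntegrableOn (fun s : ℝ => s ^ (ν - 1) * Real.exp (-(z / 2) * (s + 1 / s))) (Set.Ioi 0) := by
  refine Integrable.mono' ((bk_integrable_inv (a := -ν) (r := z / 4) (by linarith) (by linarith)).const_mul
    (Real.exp (-(1 / 2 * z)))) (bk_meas ν z).aestronglyMeasurable ?_
  refine (ae_restrict_iff' measurableSet_Ioi).2 (ae_of_all _ fun s hs => ?_)
  have hs' : (0 : ℝ) < s := hs
  rw [Real.norm_of_nonneg (by positivity)]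
  exact bk_pointwise hz hs'

lemma besselK_nonneg (ν z : ℝ) : 0 ≤ besselK ν z := by
  unfold besselK
  refine mul_nonneg (by norm_num) (setIntegral_nonneg measurableSet_Ioi fun s hs => ?_)
  have hs' : (0 : ℝ) < s := hs
  positivity

lemma besselK_le {ν z : ℝ} (hν : ν < 0) (hz : 0 < z) :
    besselK ν z ≤ 1 / 2 * (Real.exp (-(1 / 2 * z)) * ((1 / (z / 4)) ^ (-ν) * Real.Gamma (-ν))) := by
  unfold besselK
  rw [← bk_integral_inv (a := -ν) (r := z / 4) (by linarith) (by linarith)]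
  refine mul_le_mul_of_nonneg_left ?_ (show (0 : ℝ) ≤ 1 / 2 by norm_num)
  rw [← integral_const_mul]
  refine setIntegral_mono_on (bk_integrable hν hz)
    ((bk_integrable_inv (a := -ν) (r := z / 4) (by linarith) (by linarith)).const_mul _)
    measurableSet_Ioi fun s hs => bk_pointwise hz hs

lemma besselK_continuousAt {ν z : ℝ} (hν : ν < 0) (hz : 0 < z) : ContinuousAt (besselK ν) z := by
  unfold besselK
  refine ContinuousAt.const_mul ?_ _ |>.congr (Eventually.of_forall fun _ => rfl)
  refine continuousAt_of_dominated
    (bound := fun s : ℝ => s ^ (ν - 1) * Real.exp (-((z / 2) / 2) * (s + 1 / s))) ?_ ?_ ?_ ?_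
  · exact Eventually.of_forall fun y => (bk_meas ν y).aestronglyMeasurable
  · filter_upwards [lt_mem_nhds (show z / 2 < z by linarith)] with y hy
    refine (ae_restrict_iff' measurableSet_Ioi).2 (ae_of_all _ fun s hs => ?_)
    have hs' : (0 : ℝ) < s := hs
    rw [Real.norm_of_nonneg (by positivity)]
    refine mul_le_mul_of_nonneg_left (Real.exp_le_exp.2 ?_) (by positivity)
    have : 0 ≤ s + 1 / s := by positivity
    nlinarith
  · exact bk_integrable hν (by linarith)
  · exact ae_of_all _ fun s => by fun_prop

lemma besselK_measurable (ν : ℝ) : Measurable (besselK ν) := by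
  unfold besselK
  refine Measurable.const_mul ?_ _
  refine (StronglyMeasurable.integral_prod_right (ν := volume.restrict (Set.Ioi (0:ℝ)))
    (f := fun z s : ℝ => s ^ (ν - 1) * Real.exp (-(z / 2) * (s + 1 / s))) ?_).measurable
  refine Measurable.stronglyMeasurable ?_
  unfold Function.uncurry
  fun_prop

noncomputable def bkG (ν x : ℝ) : ℝ := besselK ν |x| * |x| ^ ν

lemma bkG_nonneg (ν x : ℝ) : 0 ≤ bkG ν x :=
  mul_nonneg (besselK_nonneg _ _) (by positivity)

lemma bkG_measurable (ν : ℝ) : Measurable (bkG ν) := by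
  unfold bkG
  exact ((besselK_measurable ν).comp measurable_abs).mul (by fun_prop)

lemma bkG_continuousAt {ν x : ℝ} (hν : ν < 0) (hx : x ≠ 0) : ContinuousAt (bkG ν) x := by
  unfold bkG
  have hx' : 0 < |x| := abs_pos.2 hx
  refine ContinuousAt.mul ?_ ?_
  · exact ContinuousAt.comp (f := fun x : ℝ => |x|) (g := besselK ν) (besselK_continuousAt hν hx') continuous_abs.continuousAt
  · exact continuous_abs.continuousAt.rpow_const (Or.inl hx'.ne')

lemma bkG_integrable {ν : ℝ} (hν : ν < 0) (hν' : -1 / 2 < ν) : Integrable (bkG ν) := by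
  have h1 : Integrable (fun x : ℝ => |x| ^ ((2 * ν + 1) - 1) * Real.exp (-(1 / 2 * |x|))) := by
    refine Integrable.of_integral_ne_zero ?_
    rw [integral_comp_abs (f := fun x : ℝ => x ^ ((2 * ν + 1) - 1) * Real.exp (-(1 / 2 * x))),
      Real.integral_rpow_mul_exp_neg_mul_Ioi (by linarith) (by norm_num)]
    have := Real.Gamma_pos_of_pos (show 0 < 2 * ν + 1 by linarith)
    positivity
  refine Integrable.mono' (h1.const_mul (1 / 2 * (4 ^ (-ν) * Real.Gamma (-ν))))
    (bkG_measurable ν).aestronglyMeasurable (ae_of_all _ fun x => ?_)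
  rw [Real.norm_of_nonneg (bkG_nonneg _ _)]
  have hG := Real.Gamma_pos_of_pos (show 0 < -ν by linarith)
  rcases eq_or_ne x 0 with rfl | hx
  · unfold bkG
    rw [abs_zero, Real.zero_rpow hν.ne, mul_zero]
    positivity
  · have hx' : 0 < |x| := abs_pos.2 hx
    unfold bkG
    calc _ ≤ _ := mul_le_mul_of_nonneg_right (besselK_le hν hx') (by positivity)
      _ = _ := by
        have e : (1 / (|x| / 4)) ^ (-ν) = 4 ^ (-ν) * |x| ^ ν := by
          rw [one_div_div, Real.div_rpow (by norm_num) hx'.le, Real.rpow_neg hx'.le]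
          field_simp
        have e2 : |x| ^ ((2 * ν + 1) - 1) = |x| ^ ν * |x| ^ ν := by
          rw [← Real.rpow_add hx']; congr 1; ring
        rw [e, e2]; ring

lemma ms_integrable {α b : ℝ} (hα : 1 / 2 < α) (hb : 0 < b) :
    Integrable (fun x : ℝ => (1 / (1 + b * |x| ^ α)) ^ 2) := by
  have h := integrable_one_add_norm (E := ℝ) (μ := volume) (r := 2 * α)
    (by simp only [Module.finrank_self, Nat.cast_one]; linarith)
  set m := min 1 b with hm
  have hm0 : 0 < m := lt_min one_pos hb
  have hp : 0 < (2 : ℝ) ^ α := by positivity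
  refine Integrable.mono' (h.const_mul ((2 ^ α / m) ^ 2)) ?_ (ae_of_all _ fun x => ?_)
  · apply Measurable.aestronglyMeasurable
    fun_prop
  · rw [Real.norm_of_nonneg (by positivity), Real.norm_eq_abs]
    have hx := abs_nonneg x
    have e : (1 + |x|) ^ (-(2 * α)) = (1 / (1 + |x|) ^ α) ^ 2 := by
      rw [Real.rpow_neg (by positivity), mul_comm, Real.rpow_mul (by positivity), one_div, inv_pow]
      norm_num
    rw [e, ← mul_pow]
    refine pow_le_pow_left₀ (by positivity) ?_ 2
    have h1 : (1 + |x|) ^ α ≤ 2 ^ α * (1 + |x| ^ α) := by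
      rcases le_total |x| 1 with h1 | h1
      · calc (1 + |x|) ^ α ≤ 2 ^ α := Real.rpow_le_rpow (by positivity) (by linarith) (by linarith)
          _ ≤ _ := le_mul_of_one_le_right hp.le (by linarith [Real.rpow_nonneg hx α])
      · calc (1 + |x|) ^ α ≤ (2 * |x|) ^ α := Real.rpow_le_rpow (by positivity) (by linarith) (by linarith)
          _ = 2 ^ α * |x| ^ α := Real.mul_rpow (by norm_num) hx
          _ ≤ _ := by nlinarith
    have h2 : m * (1 + |x| ^ α) ≤ 1 + b * |x| ^ α := by
      have := min_le_left 1 b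
      have := min_le_right 1 b
      nlinarith [Real.rpow_nonneg hx α]
    have hq : 0 < (1 + |x|) ^ α := by positivity
    rw [div_mul_div_comm, mul_one, div_le_div_iff₀ (by positivity) (by positivity), one_mul]
    calc m * (1 + |x|) ^ α ≤ m * (2 ^ α * (1 + |x| ^ α)) := mul_le_mul_of_nonneg_left h1 hm0.le
      _ = 2 ^ α * (m * (1 + |x| ^ α)) := by ring
      _ ≤ _ := mul_le_mul_of_nonneg_left h2 hp.le

lemma ms_abstract (E f : ℝ → ℝ) (hE : Continuous E) (c : ℝ) (hc : 0 < c)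
    (hE0 : ∀ x, 0 ≤ x → 0 ≤ E x) (hE1 : ∀ x, 0 ≤ x → E x * (1 + x * c) ≤ 1)
    (hf : Integrable f) (hfm : Measurable f) (hf0 : ∀ x, 0 ≤ f x) (hfc : ContinuousAt f 0)
    (a α γ : ℝ) (ha : 0 < a) (hα : 1 / 2 < α) (hγ : 0 < γ) :
    Tendsto (fun h : ℝ => ∫ x : ℝ,
      (E (a * |x| ^ α * (1 + x ^ 2 * h ^ 2) ^ (γ / 2)) * √(f (h * x)) - √(f 0) * E (a * |x| ^ α)) ^ 2)
      (𝓝[>] 0) (𝓝 0) := by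
  obtain ⟨δ, hδ, hδf⟩ : ∃ δ > 0, ∀ x, |x| < δ → f x ≤ f 0 + 1 := by
    have h := hfc.eventually (ge_mem_nhds (show f 0 < f 0 + 1 by linarith))
    obtain ⟨δ, hδ, h⟩ := Metric.eventually_nhds_iff.1 h
    exact ⟨δ, hδ, fun x hx => h (by simpa using hx)⟩
  -- basic bounds
  have hb1 : ∀ x, 0 ≤ x → E x ≤ 1 / (1 + x * c) := fun x hx => by
    rw [le_div_iff₀ (by positivity)]; exact hE1 x hx
  have hone : ∀ x h : ℝ, 1 ≤ (1 + x ^ 2 * h ^ 2) ^ (γ / 2) := fun x h =>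
    Real.one_le_rpow (by nlinarith [mul_nonneg (sq_nonneg x) (sq_nonneg h)]) (by linarith)
  have hge : ∀ x h : ℝ, a * |x| ^ α ≤ a * |x| ^ α * (1 + x ^ 2 * h ^ 2) ^ (γ / 2) := fun x h =>
    le_mul_of_one_le_right (by positivity) (hone x h)
  have hnn : ∀ x : ℝ, 0 ≤ a * |x| ^ α := fun x => by positivity
  have hb2 : ∀ x h : ℝ, E (a * |x| ^ α * (1 + x ^ 2 * h ^ 2) ^ (γ / 2)) ≤ 1 / (1 + a * c * |x| ^ α) := by
    intro x h
    refine (hb1 _ ((hnn x).trans (hge x h))).trans ?_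
    refine one_div_le_one_div_of_le (by positivity) ?_
    nlinarith [mul_le_mul_of_nonneg_right (hge x h) hc.le]
  have hb3 : ∀ x : ℝ, E (a * |x| ^ α) ≤ 1 / (1 + a * c * |x| ^ α) := by
    intro x
    refine (hb1 _ (hnn x)).trans (le_of_eq ?_)
    congr 2; ring
  set G : ℝ → ℝ → ℝ := fun h x =>
    (E (a * |x| ^ α * (1 + x ^ 2 * h ^ 2) ^ (γ / 2)) *
      (Set.indicator (Metric.ball (0:ℝ) δ) (fun y => √(f y)) (h * x)) - √(f 0) * E (a * |x| ^ α)) ^ 2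
    with hG
  have hGm : ∀ h, Measurable (G h) := by
    intro h
    have hm1 : Measurable (Set.indicator (Metric.ball (0:ℝ) δ) (fun y => √(f y))) :=
      Measurable.indicator (by fun_prop) measurableSet_ball
    have hEm := hE.measurable
    simp only [hG]
    fun_prop
  have hGb : ∀ h x, ‖G h x‖ ≤ (√(f 0 + 1) + √(f 0)) ^ 2 * (1 / (1 + a * c * |x| ^ α)) ^ 2 := by
    intro h x
    rw [← mul_pow, Real.norm_of_nonneg (sq_nonneg _)]
    have hi0 : 0 ≤ Set.indicator (Metric.ball (0:ℝ) δ) (fun y => √(f y)) (h * x) :=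
      Set.indicator_nonneg (fun _ _ => Real.sqrt_nonneg _) _
    have hi1 : Set.indicator (Metric.ball (0:ℝ) δ) (fun y => √(f y)) (h * x) ≤ √(f 0 + 1) := by
      refine Set.indicator_apply_le' (fun hy => ?_) (fun _ => Real.sqrt_nonneg _)
      exact Real.sqrt_le_sqrt (hδf _ (by simpa using hy))
    have p1 := hE0 _ ((hnn x).trans (hge x h))
    have p2 := hE0 _ (hnn x)
    have q := hb2 x h
    have q' := hb3 x
    have r1 := mul_le_mul q hi1 hi0 (by positivity)
    have r2 := mul_le_mul_of_nonneg_left q' (Real.sqrt_nonneg (f 0))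
    have s1 := mul_nonneg p1 hi0
    have s2 := mul_nonneg (Real.sqrt_nonneg (f 0)) p2
    refine sq_le_sq' ?_ ?_ <;> nlinarith [Real.sqrt_nonneg (f 0), Real.sqrt_nonneg (f 0 + 1)]
  have hGlim : Tendsto (fun h => ∫ x, G h x) (𝓝[>] 0) (𝓝 0) := by
    have : Tendsto (fun h => ∫ x, G h x) (𝓝[>] 0) (𝓝 (∫ _x : ℝ, (0 : ℝ))) := by
      refine tendsto_integral_filter_of_dominated_convergence
        (fun x => (√(f 0 + 1) + √(f 0)) ^ 2 * (1 / (1 + a * c * |x| ^ α)) ^ 2) ?_ ?_ ?_ ?_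
      · exact Eventually.of_forall fun h => (hGm h).aestronglyMeasurable
      · exact Eventually.of_forall fun h => ae_of_all _ fun x => hGb h x
      · exact (ms_integrable hα (by positivity)).const_mul _
      · refine ae_of_all _ fun x => ?_
        have t1 : Tendsto (fun h : ℝ => h * x) (𝓝[>] 0) (𝓝 0) := by
          have : Tendsto (fun h : ℝ => h * x) (𝓝 0) (𝓝 (0 * x)) := (continuous_id.mul continuous_const).tendsto 0
          rw [zero_mul] at this
          exact this.mono_left nhdsWithin_le_nhds
        have t2 : Tendsto (fun h : ℝ => Set.indicator (Metric.ball (0:ℝ) δ) (fun y => √(f y)) (h * x))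
            (𝓝[>] 0) (𝓝 (√(f 0))) := by
          have h3 : Tendsto (fun h : ℝ => √(f (h * x))) (𝓝[>] 0) (𝓝 (√(f 0))) :=
            (Real.continuous_sqrt.tendsto (f 0)).comp (hfc.tendsto.comp t1)
          refine h3.congr' ?_
          filter_upwards [t1.eventually (Metric.ball_mem_nhds 0 hδ)] with h hh
          exact (Set.indicator_of_mem (show h * x ∈ Metric.ball (0:ℝ) δ from hh) (fun y => √(f y))).symm
        have t3 : Tendsto (fun h : ℝ => E (a * |x| ^ α * (1 + x ^ 2 * h ^ 2) ^ (γ / 2)))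
            (𝓝[>] 0) (𝓝 (E (a * |x| ^ α))) := by
          have hcont : Continuous (fun h : ℝ => E (a * |x| ^ α * (1 + x ^ 2 * h ^ 2) ^ (γ / 2))) := by
            refine hE.comp (continuous_const.mul (Continuous.rpow_const (by fun_prop) fun h => Or.inl ?_))
            positivity
          have := (hcont.tendsto 0).mono_left (nhdsWithin_le_nhds (s := Set.Ioi (0 : ℝ)))
          simpa using this
        have t4 := ((t3.mul t2).sub_const (√(f 0) * E (a * |x| ^ α))).pow 2
        have e : (E (a * |x| ^ α) * √(f 0) - √(f 0) * E (a * |x| ^ α)) ^ 2 = 0 := by ring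
        rw [e] at t4
        exact t4
    simpa using this
  have hGint : ∀ h, Integrable (G h) := by
    intro h
    refine Integrable.mono' ((ms_integrable hα (b := a * c) (by positivity)).const_mul
      ((√(f 0 + 1) + √(f 0)) ^ 2)) (hGm h).aestronglyMeasurable (ae_of_all _ fun x => hGb h x)
  -- the tail
  set K : ℝ := (1 / (a * c * δ ^ α)) ^ 2 with hK
  have hpt : ∀ h : ℝ, 0 < h → ∀ x : ℝ,
      (E (a * |x| ^ α * (1 + x ^ 2 * h ^ 2) ^ (γ / 2)) * √(f (h * x)) - √(f 0) * E (a * |x| ^ α)) ^ 2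
        ≤ 2 * G h x + 2 * (K * h ^ (2 * α)) * f (h * x) := by
    intro h hh x
    have hrest : 0 ≤ 2 * (K * h ^ (2 * α)) * f (h * x) := by
      have := hf0 (h * x); positivity
    by_cases hx : h * x ∈ Metric.ball (0:ℝ) δ
    · simp only [hG]
      rw [Set.indicator_of_mem hx]
      nlinarith [sq_nonneg (E (a * |x| ^ α * (1 + x ^ 2 * h ^ 2) ^ (γ / 2)) * √(f (h * x)) - √(f 0) * E (a * |x| ^ α))]
    · simp only [hG]
      rw [Set.indicator_of_notMem hx]
      have hx' : δ ≤ h * |x| := by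
        rw [← abs_of_pos hh, ← abs_mul]
        simpa using hx
      have hEle : E (a * |x| ^ α * (1 + x ^ 2 * h ^ 2) ^ (γ / 2)) ≤ 1 / (a * c * δ ^ α) * h ^ α := by
        refine (hb2 x h).trans ?_
        have hxp : 0 < |x| := by
          by_contra hcon
          have : |x| = 0 := le_antisymm (not_lt.1 hcon) (abs_nonneg x)
          rw [this] at hx'; linarith
        have h1 : δ ^ α ≤ h ^ α * |x| ^ α := by
          rw [← Real.mul_rpow hh.le (abs_nonneg x)]
          exact Real.rpow_le_rpow hδ.le hx' (by linarith)
        rw [div_mul_eq_mul_div, one_mul, div_le_div_iff₀ (by positivity) (by positivity), one_mul]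
        have : 0 < h ^ α := by positivity
        nlinarith [mul_le_mul_of_nonneg_left h1 (mul_pos ha hc).le]
      have hEn := hE0 _ ((hnn x).trans (hge x h))
      have hsq : (E (a * |x| ^ α * (1 + x ^ 2 * h ^ 2) ^ (γ / 2)) * √(f (h * x))) ^ 2 ≤
          (K * h ^ (2 * α)) * f (h * x) := by
        rw [mul_pow, Real.sq_sqrt (hf0 _)]
        refine mul_le_mul_of_nonneg_right ?_ (hf0 _)
        calc _ ≤ (1 / (a * c * δ ^ α) * h ^ α) ^ 2 := pow_le_pow_left₀ hEn hEle 2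
          _ = _ := by
            rw [mul_pow, hK, mul_comm 2 α, Real.rpow_mul hh.le]; norm_num
      nlinarith [sq_nonneg (E (a * |x| ^ α * (1 + x ^ 2 * h ^ 2) ^ (γ / 2)) * √(f (h * x)) + √(f 0) * E (a * |x| ^ α))]
  have hfin : Tendsto (fun h : ℝ => 2 * (∫ x, G h x) + 2 * (K * h ^ (2 * α - 1)) * ∫ x, f x)
      (𝓝[>] 0) (𝓝 0) := by
    have hp : Tendsto (fun h : ℝ => h ^ (2 * α - 1)) (𝓝[>] 0) (𝓝 0) := by
      have := (Real.continuousAt_rpow_const 0 (2 * α - 1) (Or.inr (by linarith))).tendsto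
      rw [Real.zero_rpow (by linarith)] at this
      exact this.mono_left nhdsWithin_le_nhds
    have := (hGlim.const_mul 2).add (((hp.const_mul K).const_mul 2).mul_const (∫ x, f x))
    simpa using this
  refine tendsto_of_tendsto_of_tendsto_of_le_of_le' tendsto_const_nhds hfin
    (Eventually.of_forall fun h => integral_nonneg fun x => sq_nonneg _) ?_
  filter_upwards [self_mem_nhdsWithin] with h hh
  have hh' : (0 : ℝ) < h := hh
  have hfi : Integrable (fun x => f (h * x)) := hf.comp_mul_left' hh'.ne'
  calc _ ≤ ∫ x, (2 * G h x + 2 * (K * h ^ (2 * α)) * f (h * x)) :=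
        integral_mono_of_nonneg (ae_of_all _ fun x => sq_nonneg _)
          (((hGint h).const_mul 2).add (hfi.const_mul _)) (ae_of_all _ (hpt h hh'))
    _ = 2 * (∫ x, G h x) + 2 * (K * h ^ (2 * α - 1)) * ∫ x, f x := by
      rw [integral_add ((hGint h).const_mul 2) (hfi.const_mul _), integral_const_mul,
        integral_const_mul, Measure.integral_comp_mul_left, abs_of_pos (by positivity), smul_eq_mul,
        Real.rpow_sub_one hh'.ne']
      ring

lemma spec_eq (n : ℕ) (w κ A : ℕ → ℝ) (hA0 : A 0 = 0) (x : ℝ) :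
    specDensity n w κ A x = ∑ j ∈ Finset.Icc 1 n,
      (2 : ℝ) ^ ((1 - κ j) / 2) / (Real.sqrt Real.pi * Real.Gamma (κ j / 2)) / 2 * A j *
        (bkG ((κ j - 1) / 2) (x + w j) + bkG ((κ j - 1) / 2) (x - w j)) := by
  simp [specDensity, hA0, bkG]

lemma spec_zero (n : ℕ) (w κ A : ℕ → ℝ) (hA0 : A 0 = 0) (hw : ∀ j ∈ Finset.Icc 1 n, 0 < w j) :
    specDensity n w κ A 0 = specDensityZero n w κ A := by
  rw [spec_eq n w κ A hA0, specDensityZero]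
  refine Finset.sum_congr rfl fun j hj => ?_
  have := hw j hj
  rw [zero_add, zero_sub]
  unfold bkG
  rw [abs_neg, abs_of_pos this]
  ring

/-- Analytic core of Theorem 3.1: with `A₀ = 0` and `α > 1/2`, the mean-square distance
`E(U_ε(t,x) − U_0(t,x))² = ∫_ℝ (E_β(−μ|λ|^α(1+λ²ε^{2β/α})^{γ/2} t^β) √(f(ε^{β/α}λ))
  − √(f(0)) E_β(−μ t^β |λ|^α))² dλ` tends to `0` as `ε → 0⁺`. -/
theorem mean_square_limit_A0_zero (n : ℕ) (hn : 1 ≤ n) (w κ A : ℕ → ℝ)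
    (hw0 : w 0 = 0) (hw : ∀ j ∈ Finset.Icc 1 n, 0 < w j)
    (hκ : ∀ j ∈ Finset.range (n + 1), κ j ∈ Set.Ioo (0 : ℝ) 1)
    (hA : ∀ j ∈ Finset.range (n + 1), 0 ≤ A j)
    (hAsum : ∑ j ∈ Finset.range (n + 1), A j = 1) (hA0 : A 0 = 0)
    (β α γ μ t : ℝ) (hβ : β ∈ Set.Ioo (0 : ℝ) 1) (hα : 1 / 2 < α) (hγ : 0 < γ)
    (hμ : 0 < μ) (ht : 0 < t) :
    Filter.Tendsto
      (fun ε : ℝ =>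
        ∫ lam : ℝ,
          (mittagLeffler β
              (-(μ * |lam| ^ α * (1 + lam ^ 2 * ε ^ (2 * β / α)) ^ (γ / 2) * t ^ β)) *
            Real.sqrt (specDensity n w κ A (ε ^ (β / α) * lam)) -
          Real.sqrt (specDensityZero n w κ A) *
            mittagLeffler β (-(μ * t ^ β * |lam| ^ α))) ^ 2)
      (𝓝[>] (0 : ℝ)) (𝓝 0) := by
  have hmem : ∀ j ∈ Finset.Icc 1 n, j ∈ Finset.range (n + 1) := fun j hj => by
    have := Finset.mem_Icc.1 hj
    exact Finset.mem_range.2 (by omega)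
  have hν : ∀ j ∈ Finset.Icc 1 n, (κ j - 1) / 2 < 0 ∧ -1 / 2 < (κ j - 1) / 2 := fun j hj => by
    have := hκ j (hmem j hj)
    constructor <;> linarith [this.1, this.2]
  have hcoef : ∀ j ∈ Finset.Icc 1 n,
      0 ≤ (2 : ℝ) ^ ((1 - κ j) / 2) / (Real.sqrt Real.pi * Real.Gamma (κ j / 2)) / 2 * A j := by
    intro j hj
    have h1 := hκ j (hmem j hj)
    have h2 := hA j (hmem j hj)
    have h3 := Real.Gamma_pos_of_pos (show 0 < κ j / 2 by linarith [h1.1])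
    positivity
  have hspec : specDensity n w κ A = fun x => ∑ j ∈ Finset.Icc 1 n,
      (2 : ℝ) ^ ((1 - κ j) / 2) / (Real.sqrt Real.pi * Real.Gamma (κ j / 2)) / 2 * A j *
        (bkG ((κ j - 1) / 2) (x + w j) + bkG ((κ j - 1) / 2) (x - w j)) :=
    funext fun x => spec_eq n w κ A hA0 x
  have hfi : Integrable (specDensity n w κ A) := by
    rw [hspec]
    refine integrable_finsetSum _ fun j hj => Integrable.const_mul ?_ _
    have hb := bkG_integrable (hν j hj).1 (hν j hj).2
    exact (hb.comp_add_right (w j)).add (hb.comp_sub_right (w j))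
  have hfm : Measurable (specDensity n w κ A) := by
    rw [hspec]
    refine Finset.measurable_fun_sum _ fun j _ => Measurable.const_mul ?_ _
    have hb := bkG_measurable ((κ j - 1) / 2)
    exact (hb.comp (measurable_id.add_const (w j))).add (hb.comp (measurable_id.sub_const (w j)))
  have hf0 : ∀ x, 0 ≤ specDensity n w κ A x := by
    intro x
    rw [hspec]
    exact Finset.sum_nonneg fun j hj =>
      mul_nonneg (hcoef j hj) (add_nonneg (bkG_nonneg _ _) (bkG_nonneg _ _))
  have hfc : ContinuousAt (specDensity n w κ A) 0 := by
    rw [hspec]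
    refine tendsto_finsetSum _ fun j hj => ?_
    have hwj := hw j hj
    have c1 : ContinuousAt (fun x : ℝ => bkG ((κ j - 1) / 2) (x + w j)) 0 :=
      ContinuousAt.comp (f := fun x : ℝ => x + w j) (g := bkG ((κ j - 1) / 2))
        (bkG_continuousAt (hν j hj).1 (by simpa using hwj.ne')) (by fun_prop)
    have c2 : ContinuousAt (fun x : ℝ => bkG ((κ j - 1) / 2) (x - w j)) 0 :=
      ContinuousAt.comp (f := fun x : ℝ => x - w j) (g := bkG ((κ j - 1) / 2))
        (bkG_continuousAt (hν j hj).1 (by simpa using hwj.ne')) (by fun_prop)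
    exact (c1.add c2).const_mul _
  have hGam : 0 < 1 / Real.Gamma (1 + β) := by
    have := Real.Gamma_pos_of_pos (show 0 < 1 + β by linarith [hβ.1])
    positivity
  have key := ms_abstract (fun x => mittagLeffler β (-x)) (specDensity n w κ A)
    ((ml_continuous hβ.1 hβ.2).comp continuous_neg) (1 / Real.Gamma (1 + β)) hGam
    (fun x hx => (ml_bound hβ.1 hβ.2 hx).1) (fun x hx => (ml_bound hβ.1 hβ.2 hx).2)
    hfi hfm hf0 hfc (μ * t ^ β) α γ (by positivity) hα hγ
  have hexp : 0 < β / α := div_pos hβ.1 (by linarith)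
  have hsub : Tendsto (fun ε : ℝ => ε ^ (β / α)) (𝓝[>] 0) (𝓝[>] 0) := by
    refine tendsto_nhdsWithin_iff.2 ⟨?_, ?_⟩
    · have := (Real.continuousAt_rpow_const 0 (β / α) (Or.inr hexp.le)).tendsto
      rw [Real.zero_rpow hexp.ne'] at this
      exact this.mono_left nhdsWithin_le_nhds
    · filter_upwards [self_mem_nhdsWithin] with ε hε
      exact Real.rpow_pos_of_pos hε _
  refine (key.comp hsub).congr' ?_
  filter_upwards [self_mem_nhdsWithin] with ε hε
  have hε' : (0 : ℝ) < ε := hε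
  have e1 : (ε ^ (β / α)) ^ 2 = ε ^ (2 * β / α) := by
    rw [← Real.rpow_natCast, ← Real.rpow_mul hε'.le]
    congr 1
    push_cast
    ring
  have e2 : ∀ lam : ℝ, μ * |lam| ^ α * (1 + lam ^ 2 * ε ^ (2 * β / α)) ^ (γ / 2) * t ^ β =
      μ * t ^ β * |lam| ^ α * (1 + lam ^ 2 * ε ^ (2 * β / α)) ^ (γ / 2) := fun lam => by ring
  simp only [Function.comp, e1, e2, spec_zero n w κ A hA0 hw]
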